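/- arXiv:2605.06735 — 9 statements merged into one kernel-verified Lean document; each statement's English description precedes it below -/
import Mathlib

section
/- Let p ≥ 1 be an integer, let ε_1, …, ε_p be complex numbers, and let γ_1, …, γ_p be complex numbers satisfying the order-p moment conditions. Then ∑_{j=1}^p ε_j^{p+1} γ_j = (−1)^p ∏_{j=1}^p ε_j. (Lemma 1 of the paper.) -/
open Finset

/-- If a weighted system of nodes `x i` consists of roots of a monic polynomial `P` of positive
degree and its moments of order `1, …, P.natDegree - 1` vanish, then the moment of order
`P.natDegree` is determined by the moment of order `0` and the constant coefficient of `P`. -/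
theorem Polynomial.Monic.sum_mul_pow_natDegree_eq {ι R : Type*} [CommRing R] {P : Polynomial R}
    (hP : P.Monic) (hdeg : 1 ≤ P.natDegree) (s : Finset ι) (x w : ι → R)
    (hroot : ∀ i ∈ s, P.eval (x i) = 0)
    (hmom : ∀ k, 1 ≤ k → k < P.natDegree → ∑ i ∈ s, w i * x i ^ k = 0) :
    ∑ i ∈ s, w i * x i ^ P.natDegree = -(P.coeff 0 * ∑ i ∈ s, w i) := by
  have hsum : ∑ k ∈ range (P.natDegree + 1), P.coeff k * ∑ i ∈ s, w i * x i ^ k = 0 := by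
    calc ∑ k ∈ range (P.natDegree + 1), P.coeff k * ∑ i ∈ s, w i * x i ^ k
        = ∑ i ∈ s, w i * P.eval (x i) := by
          simp only [Polynomial.eval_eq_sum_range, mul_sum]
          rw [sum_comm]
          exact sum_congr rfl fun i _ => sum_congr rfl fun k _ => mul_left_comm _ _ _
      _ = 0 := sum_eq_zero fun i hi => by rw [hroot i hi, mul_zero]
  have hlow : ∑ k ∈ range P.natDegree, P.coeff k * ∑ i ∈ s, w i * x i ^ k
      = P.coeff 0 * ∑ i ∈ s, w i := by
    rw [sum_eq_single_of_mem 0 (mem_range.2 hdeg)]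
    · simp
    · intro k hk hk0
      rw [hmom k (Nat.one_le_iff_ne_zero.2 hk0) (mem_range.1 hk), mul_zero]
  rw [sum_range_succ, hlow, hP.coeff_natDegree, one_mul] at hsum
  exact eq_neg_of_add_eq_zero_right hsum

/-- Lemma 1 of the paper: if `γ₁, …, γ_p` satisfy the order-`p` moment conditions
relative to `ε₁, …, ε_p`, then `∑ ε_j^(p+1) γ_j = (-1)^p ∏ ε_j`. -/
theorem bdf_moment_top_identity (p : ℕ) (hp : 1 ≤ p) (ε γ : ℕ → ℂ)
    (h1 : ∑ i ∈ Icc 1 p, ε i * γ i = -1)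
    (hm : ∀ m : ℕ, 2 ≤ m → m ≤ p → ∑ i ∈ Icc 1 p, ε i ^ m * γ i = 0) :
    ∑ j ∈ Icc 1 p, ε j ^ (p + 1) * γ j = (-1) ^ p * ∏ j ∈ Icc 1 p, ε j := by
  have hshift (k : ℕ) : ∑ i ∈ Icc 1 p, ε i ^ (k + 1) * γ i
      = ∑ i ∈ Icc 1 p, ε i * γ i * ε i ^ k :=
    sum_congr rfl fun i _ => by ring
  let P : Polynomial ℂ := ∏ i ∈ Icc 1 p, (Polynomial.X - Polynomial.C (ε i))
  have hP : P.Monic := Polynomial.monic_prod_X_sub_C ε _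
  have hdeg : P.natDegree = p := by
    simp [P, Polynomial.natDegree_prod_of_monic _ _ fun i _ => Polynomial.monic_X_sub_C (ε i)]
  have hroot : ∀ i ∈ Icc 1 p, P.eval (ε i) = 0 := fun i hi => by
    rw [Polynomial.eval_prod]
    exact prod_eq_zero hi (by simp)
  have hcoeff : P.coeff 0 = (-1) ^ p * ∏ j ∈ Icc 1 p, ε j := by
    simp [P, Polynomial.coeff_zero_eq_eval_zero, Polynomial.eval_prod, prod_neg]
  have key := hP.sum_mul_pow_natDegree_eq (hdeg.symm ▸ hp) (Icc 1 p) ε (fun i => ε i * γ i) hroot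
    fun k hk hkp => by rw [← hshift]; exact hm (k + 1) (by lia) (by lia)
  rw [hdeg, h1, hcoeff] at key
  rw [hshift, key, mul_neg_one, neg_neg]
end

section
/- Let p ≥ 1 be an integer and let ε_1, …, ε_p be pairwise distinct nonzero complex numbers. Define γ_i := (−1)^p ε_i^{−1} ∏_{j=1, j≠i}^p ε_j/(ε_i − ε_j) for i = 1, …, p. Then γ_1, …, γ_p satisfy the order-p moment conditions, they are the unique p-tuple of complex numbers doing so, and the associated γ_0 = −∑_{i=1}^p γ_i equals ∑_{j=1}^p 1/ε_j. (Closed-form solution (25) of system (23) of the paper.) -/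
open Finset

namespace Lagrange

open Polynomial

variable {F ι : Type*} [Field F] [DecidableEq ι] {s : Finset ι} {v : ι → F}

theorem sum_eval_mul_eval_basis (hvs : Set.InjOn v s) {f : F[X]} (hf : f.degree < #s) (x : F) :
    ∑ i ∈ s, f.eval (v i) * (Lagrange.basis s v i).eval x = f.eval x := by
  conv_rhs => rw [eq_interpolate hvs hf, interpolate_apply]
  simp [eval_finsetSum]

theorem eval_zero_basis {i : ι} (hi : i ∈ s) :
    (Lagrange.basis s v i).eval 0 = -((-1) ^ #s * ∏ j ∈ s.erase i, v j / (v i - v j)) := by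
  have h : ∀ j, (basisDivisor (v i) (v j)).eval 0 = -1 * (v j / (v i - v j)) := fun j => by
    simp only [basisDivisor, eval_mul, eval_C, eval_sub, eval_X, div_eq_mul_inv]
    ring
  rw [Lagrange.basis, eval_prod, prod_congr rfl fun j _ => h j, prod_mul_distrib, prod_const,
    ← card_erase_add_one hi, pow_succ]
  ring

/-- A weight `w` whose moments of order less than `#s` are those of the point mass at zero
is given by the values at zero of the Lagrange basis. -/
theorem eq_eval_zero_basis_of_moments (hvs : Set.InjOn v s) {w : ι → F}
    (hw : ∀ k < #s, ∑ i ∈ s, v i ^ k * w i = 0 ^ k) {i : ι} (hi : i ∈ s) :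
    w i = (Lagrange.basis s v i).eval 0 := by
  have key : ∀ f : F[X], f.natDegree < #s → ∑ j ∈ s, f.eval (v j) * w j = f.eval 0 := by
    intro f hf
    simp only [eval_eq_sum_range' hf, sum_mul]
    rw [sum_comm]
    refine sum_congr rfl fun k hk => ?_
    rw [← hw k (mem_range.1 hk), mul_sum]
    exact sum_congr rfl fun j _ => mul_assoc _ _ _
  rw [← key (Lagrange.basis s v i)
    (by rw [natDegree_basis hvs hi]; exact Nat.sub_lt (card_pos.2 ⟨i, hi⟩) one_pos),
    sum_eq_single_of_mem i hi fun j hj hji => by rw [eval_basis_of_ne hji.symm hj, zero_mul],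
    eval_basis_self hvs hi, one_mul]

theorem sum_inv_mul_eval_zero_basis (hvs : Set.InjOn v s) (h0 : ∀ i ∈ s, v i ≠ 0) :
    ∑ i ∈ s, (v i)⁻¹ * (Lagrange.basis s v i).eval 0 = ∑ i ∈ s, (v i)⁻¹ := by
  set N : F[X] := nodal s v with hN
  have hN0 : N.eval 0 ≠ 0 := by
    rw [hN, eval_nodal, prod_ne_zero_iff]
    simpa using h0
  have hdeg : (C (-(N.eval 0)⁻¹) * N.divX).degree < #s := by
    rw [degree_C_mul (neg_ne_zero.2 (inv_ne_zero hN0)), ← degree_nodal (s := s) (v := v)]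
    exact degree_divX_lt nodal_ne_zero
  have hnode : ∀ i ∈ s, (v i)⁻¹ = (C (-(N.eval 0)⁻¹) * N.divX).eval (v i) := fun i hi => by
    have h := congrArg (eval (v i)) (divX_mul_X_add N)
    rw [eval_add, eval_mul, eval_X, eval_C, coeff_zero_eq_eval_zero, hN, eval_nodal_at_node hi,
      ← hN] at h
    have := h0 i hi
    rw [eval_mul, eval_C]
    field_simp
    linear_combination h
  rw [sum_congr rfl fun i hi => by rw [hnode i hi], sum_eval_mul_eval_basis hvs hdeg, eval_mul,
    eval_C, ← coeff_zero_eq_eval_zero N.divX, coeff_divX, zero_add]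
  have hder : N.coeff 1 = (derivative N).eval 0 := by
    simp [← coeff_zero_eq_eval_zero, coeff_derivative]
  rw [hder, hN, derivative_nodal, eval_finsetSum, mul_sum]
  refine sum_congr rfl fun i hi => ?_
  have hmul := congrArg (eval 0) (nodal_eq_mul_nodal_erase (v := v) hi)
  rw [eval_mul, eval_sub, eval_X, eval_C, zero_sub] at hmul
  have := h0 i hi
  rw [← hN] at hmul ⊢
  field_simp
  linear_combination -hmul

end Lagrange



/-- Closed-form solution (25) of the order-`p` moment system (23):
for pairwise distinct nonzero `ε₁, …, ε_p`, the numbers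
`γ_i = (-1)^p ε_i⁻¹ ∏_{j≠i} ε_j/(ε_i - ε_j)` satisfy the order-`p` moment
conditions, are the unique such tuple, and `γ₀ = -∑ γ_i = ∑ 1/ε_j`. -/
theorem bdf_closed_form_solution (p : ℕ) (hp : 1 ≤ p) (ε : ℕ → ℂ)
    (hne : ∀ i ∈ Icc 1 p, ε i ≠ 0)
    (hdist : ∀ i ∈ Icc 1 p, ∀ j ∈ Icc 1 p, i ≠ j → ε i ≠ ε j)
    (γ : ℕ → ℂ)
    (hγ : ∀ i ∈ Icc 1 p,
      γ i = (-1) ^ p * (ε i)⁻¹ * ∏ j ∈ (Icc 1 p).erase i, ε j / (ε i - ε j)) :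
    (∑ i ∈ Icc 1 p, ε i * γ i = -1) ∧
    (∀ m : ℕ, 2 ≤ m → m ≤ p → ∑ i ∈ Icc 1 p, ε i ^ m * γ i = 0) ∧
    (∀ δ : ℕ → ℂ,
      (∑ i ∈ Icc 1 p, ε i * δ i = -1) →
      (∀ m : ℕ, 2 ≤ m → m ≤ p → ∑ i ∈ Icc 1 p, ε i ^ m * δ i = 0) →
      ∀ i ∈ Icc 1 p, δ i = γ i) ∧
    (-∑ i ∈ Icc 1 p, γ i = ∑ j ∈ Icc 1 p, (ε j)⁻¹) := by
  have hvs : Set.InjOn ε (Icc 1 p : Finset ℕ) := fun i hi j hj h =>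
    by_contra fun hij => hdist i hi j hj hij h
  have hcard : #(Icc 1 p) = p := by simp
  have hbasis : ∀ i ∈ Icc 1 p, ε i * γ i = -(Lagrange.basis (Icc 1 p) ε i).eval 0 := by
    intro i hi
    rw [hγ i hi, Lagrange.eval_zero_basis hi, hcard]
    field_simp [hne i hi]
  have hmoment : ∀ k < p, ∑ i ∈ Icc 1 p, ε i ^ (k + 1) * γ i = -0 ^ k := by
    intro k hk
    have h := Lagrange.sum_eval_mul_eval_basis hvs (f := Polynomial.X ^ k)
      (by rw [Polynomial.degree_X_pow, hcard]; exact_mod_cast hk) 0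
    simp only [Polynomial.eval_pow, Polynomial.eval_X] at h
    rw [← h, ← sum_neg_distrib]
    refine sum_congr rfl fun i hi => ?_
    rw [pow_succ, mul_assoc, hbasis i hi, mul_neg]
  refine ⟨by simpa using hmoment 0 hp, fun m hm hmp => ?_, fun δ h1 h2 i hi => ?_, ?_⟩
  · obtain ⟨k, rfl⟩ := Nat.exists_eq_add_of_le' (one_le_two.trans hm)
    simpa [show k ≠ 0 by omega] using hmoment k hmp
  · have hw : ∀ k < #(Icc 1 p), ∑ i ∈ Icc 1 p, ε i ^ k * -(ε i * δ i) = 0 ^ k := by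
      intro k hk
      rw [hcard] at hk
      simp only [mul_neg, ← mul_assoc, ← pow_succ, sum_neg_distrib]
      rcases Nat.eq_zero_or_pos k with rfl | hk0
      · simp [h1]
      · rw [h2 (k + 1) (by omega) hk, neg_zero, zero_pow hk0.ne']
    refine mul_left_cancel₀ (hne i hi) ?_
    rw [hbasis i hi, ← Lagrange.eq_eval_zero_basis_of_moments hvs hw hi, neg_neg]
  · rw [← Lagrange.sum_inv_mul_eval_zero_basis hvs hne, ← sum_neg_distrib]
    refine sum_congr rfl fun i hi => ?_
    rw [← neg_eq_iff_eq_neg.2 (hbasis i hi), mul_neg, inv_mul_cancel_left₀ (hne i hi)]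
end

section
/- Let p ≥ 1 be an integer, ε_1, …, ε_p complex numbers, and γ_1, …, γ_p complex numbers satisfying the order-p moment conditions, with γ_0 := −∑_{i=1}^p γ_i. Let a_1 ∈ ℂ and set E_0 := 1 − a_1 and E_i := 1 − a_1 + a_1 ε_i for i = 1, …, p. Then for every integer j with 1 ≤ j ≤ p, −∑_{i=1}^p E_i^j γ_i = E_0^{j−1}(j·a_1 + E_0 γ_0). (Proposition 2 of the paper, identity (32).) -/
open Finset

/-- A weighted power sum of affinely shifted nodes only sees the moments of order `0` and `1`
when the higher moments vanish. -/
theorem sum_add_mul_pow_mul_of_moments_eq_zero {ι R : Type*} [CommRing R] (s : Finset ι)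
    (ε γ : ι → R) (x a : R) (n : ℕ)
    (h : ∀ m, 2 ≤ m → m ≤ n + 1 → ∑ i ∈ s, ε i ^ m * γ i = 0) :
    ∑ i ∈ s, (x + a * ε i) ^ (n + 1) * γ i =
      x ^ (n + 1) * ∑ i ∈ s, γ i + (n + 1) * x ^ n * a * ∑ i ∈ s, ε i * γ i := by
  have expand : ∑ i ∈ s, (x + a * ε i) ^ (n + 1) * γ i =
      ∑ m ∈ range (n + 2), a ^ m * x ^ (n + 1 - m) * ((n + 1).choose m : R) *
        ∑ i ∈ s, ε i ^ m * γ i := by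
    simp_rw [mul_sum]
    rw [sum_comm]
    refine sum_congr rfl fun i _ => ?_
    rw [add_comm x, add_pow, sum_mul]
    exact sum_congr rfl fun m _ => by ring
  rw [expand, sum_range_succ', sum_range_succ', sum_eq_zero fun m hm => ?_]
  · simp
    ring
  · rw [h (m + 1 + 1) (by omega) (by have := mem_range.mp hm; omega), mul_zero]

/-- Proposition 2, identity (32) of the paper: if `γ₁, …, γ_p` satisfy the order-`p`
moment conditions, `γ₀ = -∑ γ_i`, `E₀ = 1 - a₁` and `E_i = 1 - a₁ + a₁ ε_i`, then
for all `1 ≤ j ≤ p`, `-∑ E_i^j γ_i = E₀^(j-1) (j a₁ + E₀ γ₀)`. -/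
theorem moment_shift_identity (p : ℕ) (hp : 1 ≤ p) (ε γ : ℕ → ℂ)
    (h1 : ∑ i ∈ Icc 1 p, ε i * γ i = -1)
    (hm : ∀ m : ℕ, 2 ≤ m → m ≤ p → ∑ i ∈ Icc 1 p, ε i ^ m * γ i = 0)
    (γ0 : ℂ) (hγ0 : γ0 = -∑ i ∈ Icc 1 p, γ i)
    (a1 E0 : ℂ) (hE0 : E0 = 1 - a1)
    (E : ℕ → ℂ) (hE : ∀ i, 1 ≤ i → i ≤ p → E i = 1 - a1 + a1 * ε i) :
    ∀ j : ℕ, 1 ≤ j → j ≤ p →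
      -∑ i ∈ Icc 1 p, E i ^ j * γ i = E0 ^ (j - 1) * (j * a1 + E0 * γ0) := by
  intro j hj hjp
  obtain ⟨n, rfl⟩ := Nat.exists_eq_add_of_le' hj
  have hsum : ∑ i ∈ Icc 1 p, E i ^ (n + 1) * γ i =
      ∑ i ∈ Icc 1 p, (E0 + a1 * ε i) ^ (n + 1) * γ i :=
    sum_congr rfl fun i hi => by rw [hE i (mem_Icc.mp hi).1 (mem_Icc.mp hi).2, hE0]
  rw [hsum, sum_add_mul_pow_mul_of_moments_eq_zero _ _ _ _ _ _
    fun m h2 hmn => hm m h2 (hmn.trans hjp), h1, hγ0, Nat.add_sub_cancel]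
  push_cast
  ring
end

section
/- Let p ≥ 1 be an integer, ε_1, …, ε_p complex numbers, and γ_1, …, γ_p complex numbers satisfying the order-p moment conditions, with γ_0 := −∑_{i=1}^p γ_i. Let a_1 ∈ ℂ and set E_0 := 1 − a_1 and E_i := 1 − a_1 + a_1 ε_i for i = 1, …, p. Then −∑_{i=1}^p E_i^{p+1} γ_i = E_0^p((p+1)·a_1 + E_0 γ_0) + (−1)^{p+1} a_1^{p+1} ∏_{i=1}^p ε_i. (Proposition 2 of the paper, identity (33).) -/
open Finset

open Polynomial in
/-- Under the order-`p` moment conditions, the functional `f ↦ ∑ f(ε i) γ i` on polynomials of degree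
at most `p` only sees the two lowest coefficients of `f`. -/
lemma sum_eval_mul_of_moments {R ι : Type*} [CommRing R] {p : ℕ} (hp : 1 ≤ p) {s : Finset ι}
    {ε γ : ι → R} (h1 : ∑ i ∈ s, ε i * γ i = -1)
    (hm : ∀ m : ℕ, 2 ≤ m → m ≤ p → ∑ i ∈ s, ε i ^ m * γ i = 0)
    {f : R[X]} (hf : f.natDegree ≤ p) :
    ∑ i ∈ s, f.eval (ε i) * γ i = f.coeff 0 * ∑ i ∈ s, γ i - f.coeff 1 := by
  have expand : ∑ i ∈ s, f.eval (ε i) * γ i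
      = ∑ m ∈ range (p + 1), f.coeff m * ∑ i ∈ s, ε i ^ m * γ i := by
    simp_rw [eval_eq_sum_range' (Nat.lt_succ_of_le hf), sum_mul, mul_sum]
    rw [sum_comm]
    simp only [mul_assoc]
  obtain ⟨q, rfl⟩ := Nat.exists_eq_add_of_le' hp
  rw [expand, sum_range_succ', sum_range_succ', sum_eq_zero]
  · simp [h1]
    ring
  · intro m hmq
    rw [mem_range] at hmq
    rw [hm (m + 1 + 1) (by omega) (by omega), mul_zero]

open Polynomial in
/-- Subtracting a multiple of the monic polynomial `X * P` cancels the leading term of a power of a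
linear polynomial. -/
lemma natDegree_linear_pow_sub_le {R : Type*} [CommRing R] {p : ℕ} {P : R[X]}
    (hP : P.Monic) (hdeg : P.natDegree = p) (a b : R) :
    ((C a * X + C b) ^ (p + 1) - C (a ^ (p + 1)) * (X * P)).natDegree ≤ p := by
  have hlin : (C a * X + C b).natDegree ≤ 1 := natDegree_linear_le
  have hpow : ((C a * X + C b) ^ (p + 1)).natDegree ≤ p + 1 := by
    simpa using natDegree_pow_le_of_le (p + 1) hlin
  have hmul : (C (a ^ (p + 1)) * (X * P)).natDegree ≤ p + 1 := by
    refine (natDegree_C_mul_le _ _).trans (natDegree_mul_le.trans ?_)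
    have := natDegree_X_le (R := R)
    omega
  have htop : ((C a * X + C b) ^ (p + 1)).coeff (p + 1) = a ^ (p + 1) := by
    simpa using coeff_pow_of_natDegree_le (m := p + 1) hlin
  have hPtop : P.coeff p = 1 := hdeg ▸ hP.coeff_natDegree
  rw [natDegree_le_iff_coeff_eq_zero]
  intro N hN
  obtain rfl | hlt := (Nat.succ_le_of_lt hN).eq_or_lt
  · rw [coeff_sub, coeff_C_mul, Nat.succ_eq_add_one, coeff_X_mul, htop, hPtop, mul_one, sub_self]
  · exact coeff_eq_zero_of_natDegree_lt
      (((natDegree_sub_le _ _).trans (max_le hpow hmul)).trans_lt hlt)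

/-- Proposition 2, identity (33) of the paper: if `γ₁, …, γ_p` satisfy the order-`p`
moment conditions, `γ₀ = -∑ γ_i`, `E₀ = 1 - a₁` and `E_i = 1 - a₁ + a₁ ε_i`, then
`-∑ E_i^(p+1) γ_i = E₀^p ((p+1) a₁ + E₀ γ₀) + (-1)^(p+1) a₁^(p+1) ∏ ε_i`. -/
theorem moment_shift_top_identity (p : ℕ) (hp : 1 ≤ p) (ε γ : ℕ → ℂ)
    (h1 : ∑ i ∈ Icc 1 p, ε i * γ i = -1)
    (hm : ∀ m : ℕ, 2 ≤ m → m ≤ p → ∑ i ∈ Icc 1 p, ε i ^ m * γ i = 0)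
    (γ0 : ℂ) (hγ0 : γ0 = -∑ i ∈ Icc 1 p, γ i)
    (a1 E0 : ℂ) (hE0 : E0 = 1 - a1)
    (E : ℕ → ℂ) (hE : ∀ i, 1 ≤ i → i ≤ p → E i = 1 - a1 + a1 * ε i) :
    -∑ i ∈ Icc 1 p, E i ^ (p + 1) * γ i
      = E0 ^ p * ((p + 1 : ℕ) * a1 + E0 * γ0)
        + (-1) ^ (p + 1) * a1 ^ (p + 1) * ∏ i ∈ Icc 1 p, ε i := by
  set P : Polynomial ℂ := ∏ i ∈ Icc 1 p, (.X - .C (ε i)) with hPdef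
  have hP : P.Monic := Polynomial.monic_prod_X_sub_C _ _
  have hdeg : P.natDegree = p := by simp [hPdef]
  have hP0 : P.coeff 0 = (-1) ^ p * ∏ i ∈ Icc 1 p, ε i := by
    simp [hPdef, Polynomial.coeff_zero_eq_eval_zero, Polynomial.eval_prod, prod_neg]
  have key := sum_eval_mul_of_moments hp h1 hm (natDegree_linear_pow_sub_le hP hdeg a1 E0)
  have heval : ∀ i ∈ Icc 1 p, Polynomial.eval (ε i)
      ((.C a1 * .X + .C E0) ^ (p + 1) - .C (a1 ^ (p + 1)) * (.X * P)) = E i ^ (p + 1) := by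
    intro i hi
    have hroot : P.eval (ε i) = 0 := by
      rw [hPdef, Polynomial.eval_prod]
      exact prod_eq_zero hi (by simp)
    obtain ⟨hi1, hip⟩ := mem_Icc.1 hi
    simp [hroot, hE i hi1 hip, hE0, add_comm]
  have hc0 : ((.C a1 * .X + .C E0) ^ (p + 1) : Polynomial ℂ).coeff 0 = E0 ^ (p + 1) := by
    simp [Polynomial.coeff_zero_eq_eval_zero]
  have hc1 : ((.C a1 * .X + .C E0) ^ (p + 1) : Polynomial ℂ).coeff 1
      = (p + 1) * E0 ^ p * a1 := by
    have h := Polynomial.coeff_derivative ((.C a1 * .X + .C E0) ^ (p + 1) : Polynomial ℂ) 0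
    rw [Polynomial.coeff_zero_eq_eval_zero] at h
    simpa [Polynomial.derivative_pow] using h.symm
  rw [sum_congr rfl fun i hi => by rw [heval i hi]] at key
  rw [key, Polynomial.coeff_sub, Polynomial.coeff_sub, Polynomial.coeff_C_mul,
    Polynomial.coeff_C_mul, Polynomial.coeff_X_mul_zero, Polynomial.coeff_X_mul P 0, hc0, hc1,
    hP0, hγ0]
  push_cast
  ring
end

section
/- Let p ≥ 1 be an integer, ε_1, …, ε_p complex numbers, and γ_1, …, γ_p complex numbers satisfying the order-p moment conditions, with γ_0 := −∑_{i=1}^p γ_i. Let a_1 ∈ ℂ and set E_0 := 1 − a_1 and E_i := 1 − a_1 + a_1 ε_i for i = 1, …, p. Define c_0 := ∑_{i=0}^p γ_i and, for every integer j ≥ 1, c_j := ((−1)^j / j!)(γ_0 E_0^j + ∑_{i=1}^p γ_i E_i^j + j·a_1·E_0^{j−1}). Then c_j = 0 for all 0 ≤ j ≤ p, and c_{p+1} = −(a_1^{p+1}/(p+1)!) ∏_{i=1}^p ε_i. (The Taylor coefficients E_j of the difference operator of the first composition step vanish up to order p, with leading coefficient given by equation (44) of the paper.) -/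
open Finset

/-- A weighted sum of values of a polynomial is the combination of the moments of the
weights given by its coefficients. -/
theorem sum_mul_eval_eq_sum_coeff_mul_moment {R ι : Type*} [CommRing R] (s : Finset ι)
    (x w : ι → R) (Q : Polynomial R) {n : ℕ} (hn : Q.natDegree < n) :
    ∑ i ∈ s, w i * Q.eval (x i) = ∑ k ∈ range n, Q.coeff k * ∑ i ∈ s, x i ^ k * w i := by
  simp only [Polynomial.eval_eq_sum_range' hn, mul_sum]
  rw [sum_comm]
  refine sum_congr rfl fun k _ => sum_congr rfl fun i _ => ?_
  ring

/-- If the moments of orders `2, …, p` of `p` weighted nodes vanish and the first one is `-1`,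
the moment of order `p + 1` is determined by the product of the nodes. -/
theorem moment_card_add_one {R ι : Type*} [CommRing R] (s : Finset ι) (x w : ι → R)
    (hs : s.Nonempty) (h1 : ∑ i ∈ s, x i * w i = -1)
    (hm : ∀ m : ℕ, 2 ≤ m → m ≤ #s → ∑ i ∈ s, x i ^ m * w i = 0) :
    ∑ i ∈ s, x i ^ (#s + 1) * w i = (-1) ^ #s * ∏ i ∈ s, x i := by
  nontriviality R
  let Q : Polynomial R := ∏ i ∈ s, (Polynomial.X - Polynomial.C (x i))
  have hQ : Q.Monic := Polynomial.monic_prod_X_sub_C x s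
  have hdeg : Q.natDegree = #s := Polynomial.natDegree_finsetProd_X_sub_C_eq_card s x
  have hroot : ∀ i ∈ s, Q.eval (x i) = 0 := fun i hi => by
    simp only [Q, Polynomial.eval_prod]
    exact prod_eq_zero hi (by simp)
  have hzero : Q.coeff 0 = (-1) ^ #s * ∏ i ∈ s, x i := by
    simp [Q, Polynomial.coeff_zero_eq_eval_zero, Polynomial.eval_prod, prod_neg]
  have htop : Q.coeff #s = 1 := hdeg ▸ hQ.coeff_natDegree
  have key := sum_mul_eval_eq_sum_coeff_mul_moment s x (fun i => x i * w i) Q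
    (n := #s + 1) (by omega)
  rw [sum_eq_zero fun i hi => by rw [hroot i hi, mul_zero]] at key
  simp only [← mul_assoc, ← pow_succ] at key
  obtain ⟨q, hq⟩ : ∃ q, #s = q + 1 := Nat.exists_eq_add_one.mpr hs.card_pos
  rw [sum_range_succ, htop, one_mul, hq, sum_range_succ',
    sum_eq_zero fun k hk => by
      rw [hm (k + 1 + 1) (by omega) (by have := mem_range.mp hk; omega), mul_zero],
    ← hq, hzero] at key
  simp only [zero_add, pow_one, h1] at key
  linear_combination -key

/-- Binomial expansion of a weighted sum of shifted powers, with the terms of order zero and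
one split off. -/
theorem sum_mul_add_pow_eq_moments {R ι : Type*} [CommRing R] (s : Finset ι) (x w : ι → R)
    (a b : R) (n : ℕ) :
    ∑ i ∈ s, w i * (b + a * x i) ^ (n + 1) =
      b ^ (n + 1) * ∑ i ∈ s, w i + (n + 1) * a * b ^ n * ∑ i ∈ s, x i * w i +
        ∑ k ∈ range n, a ^ (k + 2) * b ^ (n - (k + 1)) * (n + 1).choose (k + 2) *
          ∑ i ∈ s, x i ^ (k + 2) * w i := by
  have expand : ∀ i, w i * (b + a * x i) ^ (n + 1) =
      b ^ (n + 1) * w i + (n + 1) * a * b ^ n * (x i * w i) +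
        ∑ k ∈ range n, a ^ (k + 2) * b ^ (n - (k + 1)) * (n + 1).choose (k + 2) *
          (x i ^ (k + 2) * w i) := fun i => by
    rw [add_comm b, add_pow, sum_range_succ', sum_range_succ', mul_add, mul_add, mul_sum]
    have : ∀ k ∈ range n, w i * ((a * x i) ^ (k + 1 + 1) * b ^ (n + 1 - (k + 1 + 1)) *
        (n + 1).choose (k + 1 + 1)) = a ^ (k + 2) * b ^ (n - (k + 1)) *
          (n + 1).choose (k + 2) * (x i ^ (k + 2) * w i) := fun k _ => by
      rw [Nat.add_sub_add_right]
      ring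
    rw [sum_congr rfl this]
    simp
    ring
  simp only [expand, sum_add_distrib, mul_sum]
  rw [sum_comm]

/-- The Taylor coefficients of the difference operator of the first composition step
vanish up to order `p`, with leading coefficient given by equation (44) of the paper:
`c_j = 0` for `0 ≤ j ≤ p` and `c_{p+1} = -(a₁^(p+1)/(p+1)!) ∏ ε_i`. -/
theorem first_jump_taylor_coefficients (p : ℕ) (hp : 1 ≤ p) (ε γ : ℕ → ℂ)
    (h1 : ∑ i ∈ Icc 1 p, ε i * γ i = -1)
    (hm : ∀ m : ℕ, 2 ≤ m → m ≤ p → ∑ i ∈ Icc 1 p, ε i ^ m * γ i = 0)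
    (γ0 : ℂ) (hγ0 : γ0 = -∑ i ∈ Icc 1 p, γ i)
    (a1 E0 : ℂ) (hE0 : E0 = 1 - a1)
    (E : ℕ → ℂ) (hE : ∀ i, 1 ≤ i → i ≤ p → E i = 1 - a1 + a1 * ε i)
    (c : ℕ → ℂ)
    (hc0 : c 0 = γ0 + ∑ i ∈ Icc 1 p, γ i)
    (hcj : ∀ j : ℕ, 1 ≤ j →
      c j = (-1) ^ j / (Nat.factorial j : ℂ) *
        (γ0 * E0 ^ j + ∑ i ∈ Icc 1 p, γ i * E i ^ j + j * a1 * E0 ^ (j - 1))) :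
    (∀ j ≤ p, c j = 0) ∧
    c (p + 1) = -(a1 ^ (p + 1) / (Nat.factorial (p + 1) : ℂ)) * ∏ i ∈ Icc 1 p, ε i := by
  have hcard : #(Icc 1 p) = p := by simp
  have hsucc : ∀ n : ℕ, c (n + 1) = (-1) ^ (n + 1) / (Nat.factorial (n + 1) : ℂ) *
      ∑ k ∈ range n, a1 ^ (k + 2) * E0 ^ (n - (k + 1)) * (n + 1).choose (k + 2) *
        ∑ i ∈ Icc 1 p, ε i ^ (k + 2) * γ i := fun n => by
    have hsum : ∑ i ∈ Icc 1 p, γ i * E i ^ (n + 1) =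
        ∑ i ∈ Icc 1 p, γ i * (E0 + a1 * ε i) ^ (n + 1) :=
      sum_congr rfl fun i hi => by rw [hE i (mem_Icc.mp hi).1 (mem_Icc.mp hi).2, hE0]
    rw [hcj (n + 1) (by omega), hsum, sum_mul_add_pow_eq_moments, h1, hγ0]
    push_cast
    ring
  constructor
  · rintro (_ | n) hn
    · rw [hc0, hγ0, neg_add_cancel]
    · rw [hsucc, sum_eq_zero fun k hk => by
        rw [hm (k + 2) (by omega) (by have := mem_range.mp hk; omega), mul_zero], mul_zero]
  · have hmoment := moment_card_add_one (Icc 1 p) ε γ (nonempty_Icc.mpr hp) h1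
      (by rwa [hcard])
    rw [hcard] at hmoment
    obtain ⟨q, rfl⟩ : ∃ q, p = q + 1 := Nat.exists_eq_add_one.mpr hp
    rw [hsucc, sum_range_succ, sum_eq_zero fun k hk => by
      rw [hm (k + 2) (by omega) (by have := mem_range.mp hk; omega), mul_zero], hmoment]
    have hsign : ((-1 : ℂ) ^ (q + 1)) * (-1) ^ (q + 1) = 1 := by
      rw [← mul_pow]; simp
    simp only [Nat.sub_self, pow_zero, Nat.choose_self, Nat.cast_one, zero_add, mul_one,
      pow_succ _ (q + 1)]
    linear_combination -(a1 ^ (q + 1) * a1 / (Nat.factorial (q + 1 + 1) : ℂ) *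
      ∏ i ∈ Icc 1 (q + 1), ε i) * hsign
end

section
/- Assume the composed-BDF setup. Then the composed-BDF system has a unique solution (Γ_0, …, Γ_{p+1}), and Γ_1 = −(γ_0 E_0/(E_0 γ_0 − a_1)) · ∏_{i=1}^p (1 + ρ_i)/(a_1 + ρ_i). (Proposition 1 of the paper, formula for Γ_1.) -/
open Finset

/-- The composed-BDF linear system (system (34) of the paper) for the unknowns
`Γ 0, …, Γ (p+1)`. -/
def ComposedBDFSystem (p : ℕ) (E0 : ℂ) (E ε : ℕ → ℂ) (γ0 a1 : ℂ) (Γ : ℕ → ℂ) : Prop :=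
  (∑ i ∈ range (p + 2), Γ i = 0) ∧
  (Γ 1 * E0 + ∑ i ∈ Icc 1 p, Γ (i + 1) * E i = -E0) ∧
  (∀ m : ℕ, 2 ≤ m → m ≤ p →
    Γ 1 * E0 ^ m + ∑ i ∈ Icc 1 p, Γ (i + 1) * E i ^ m = 0) ∧
  (Γ 1 * (E0 ^ (p + 1) + (-a1) ^ (p + 1) * (∏ i ∈ Icc 1 p, ε i) / γ0)
    + ∑ i ∈ Icc 1 p, Γ (i + 1) * E i ^ (p + 1) = 0)

open Polynomial in
/-- Perturbed power moments `∑ Γ i * x i ^ k`, `k ≤ n`, extended linearly to polynomials. -/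
lemma sum_mul_eval_add_of_moments {ι K : Type*} [Field K] {s : Finset ι} {n : ℕ}
    {x Γ : ι → K} {d : K} {b : ℕ → K}
    (h : ∀ k ≤ n, ∑ i ∈ s, Γ i * x i ^ k + (if k = n then d else 0) = b k)
    {q : K[X]} (hq : q.natDegree ≤ n) :
    ∑ i ∈ s, Γ i * q.eval (x i) + d * q.coeff n = ∑ k ∈ range (n + 1), q.coeff k * b k := by
  have hb : ∀ k ∈ range (n + 1), q.coeff k * b k =
      ∑ i ∈ s, Γ i * (q.coeff k * x i ^ k) + (if k = n then d * q.coeff k else 0) := by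
    intro k hk
    rw [← h k (Nat.lt_succ_iff.mp (mem_range.mp hk)), mul_add, mul_sum]
    congr 1
    · exact sum_congr rfl fun i _ => by ring
    · split_ifs <;> ring
  rw [sum_congr rfl hb, sum_add_distrib, sum_comm]
  congr 1
  · refine sum_congr rfl fun i _ => ?_
    rw [eval_eq_sum_range' (Nat.lt_succ_iff.mpr hq), mul_sum]
  · simp

section PerturbedVandermonde

variable {ι K : Type*} [DecidableEq ι] [Field K] {s : Finset ι} {n : ℕ} {o : ι}
  {x Γ : ι → K} {c : K}

open Polynomial in
/-- Eliminating all unknowns but the one at the perturbed node `o`. -/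
lemma perturbed_vandermonde_coord {b : ℕ → K} (hs : s.card = n + 1) (ho : o ∈ s)
    (h : ∀ k ≤ n, ∑ i ∈ s, Γ i * x i ^ k + (if k = n then Γ o * c else 0) = b k) :
    Γ o * (∏ j ∈ s.erase o, (x o - x j) + c) =
      ∑ k ∈ range (n + 1), (∏ j ∈ s.erase o, (X - C (x j))).coeff k * b k := by
  have hcard : (s.erase o).card = n := by rw [card_erase_of_mem ho, hs, Nat.add_sub_cancel]
  have hdeg : (∏ j ∈ s.erase o, (X - C (x j))).natDegree = n := by
    rw [natDegree_finsetProd_X_sub_C_eq_card, hcard]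
  have hlead : (∏ j ∈ s.erase o, (X - C (x j))).coeff n = 1 := by
    have := (monic_prod_X_sub_C x (s.erase o)).coeff_natDegree
    rwa [hdeg] at this
  rw [← sum_mul_eval_add_of_moments h hdeg.le, hlead, sum_eq_single_of_mem o ho]
  · simp only [eval_prod, eval_sub, eval_X, eval_C]
    ring
  · intro i hi hio
    rw [eval_prod, prod_eq_zero (mem_erase.mpr ⟨hio, hi⟩) (by simp), mul_zero]

open Polynomial in
/-- A Vandermonde system whose top row is perturbed at the node `o` has trivial kernel. -/
lemma perturbed_vandermonde_ker (hs : s.card = n + 1) (ho : o ∈ s)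
    (hx : Set.InjOn x (s.erase o)) (hc : ∏ j ∈ s.erase o, (x o - x j) + c ≠ 0)
    (h : ∀ k ≤ n, ∑ i ∈ s, Γ i * x i ^ k + (if k = n then Γ o * c else 0) = 0) :
    ∀ i ∈ s, Γ i = 0 := by
  have hΓo : Γ o = 0 := by
    have := perturbed_vandermonde_coord (b := 0) hs ho h
    simpa [hc] using this
  intro i hi
  by_cases hio : i = o
  · rw [hio, hΓo]
  have hi' : i ∈ s.erase o := mem_erase.mpr ⟨hio, hi⟩
  have hdeg : (∏ j ∈ (s.erase o).erase i, (X - C (x j))).natDegree ≤ n := by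
    rw [natDegree_finsetProd_X_sub_C_eq_card, card_erase_of_mem hi', card_erase_of_mem ho]
    omega
  have hsum := sum_mul_eval_add_of_moments (b := 0) h hdeg
  rw [hΓo, sum_eq_single_of_mem i hi] at hsum
  · have hne : (∏ j ∈ (s.erase o).erase i, (X - C (x j))).eval (x i) ≠ 0 := by
      simp only [eval_prod, eval_sub, eval_X, eval_C]
      refine prod_ne_zero_iff.mpr fun j hj => sub_ne_zero.mpr fun hij => ?_
      exact (mem_erase.mp hj).1 (hx (mem_of_mem_erase hj) hi' hij.symm)
    simpa [hne] using hsum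
  · intro j hj hji
    by_cases hjo : j = o
    · rw [hjo, hΓo, zero_mul]
    · rw [eval_prod, prod_eq_zero (mem_erase.mpr ⟨hji, mem_erase.mpr ⟨hjo, hj⟩⟩) (by simp),
        mul_zero]

end PerturbedVandermonde

/-- A Vandermonde system whose top row is perturbed at the node `o` is solvable. -/
lemma exists_perturbed_vandermonde {K : Type*} [Field K] {n o : ℕ} {x : ℕ → K} {c : K}
    (ho : o ∈ range (n + 1)) (hx : Set.InjOn x ((range (n + 1)).erase o))
    (hc : ∏ j ∈ (range (n + 1)).erase o, (x o - x j) + c ≠ 0) (b : ℕ → K) :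
    ∃ Γ : ℕ → K, ∀ k ≤ n,
      ∑ i ∈ range (n + 1), Γ i * x i ^ k + (if k = n then Γ o * c else 0) = b k := by
  let ext (Γ : Fin (n + 1) → K) (i : ℕ) : K := if hi : i < n + 1 then Γ ⟨i, hi⟩ else 0
  have hext : ∀ Γ (i : Fin (n + 1)), ext Γ i = Γ i := fun Γ i => dif_pos i.isLt
  have ho' : o < n + 1 := mem_range.mp ho
  let T : (Fin (n + 1) → K) →ₗ[K] (Fin (n + 1) → K) :=
    { toFun := fun Γ k => ∑ i : Fin (n + 1), Γ i * x i ^ (k : ℕ) +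
        (if (k : ℕ) = n then Γ ⟨o, ho'⟩ * c else 0)
      map_add' := by
        intro Γ Γ'
        ext k
        simp only [Pi.add_apply, add_mul, sum_add_distrib]
        split_ifs <;> ring
      map_smul' := by
        intro r Γ
        ext k
        simp only [Pi.smul_apply, smul_eq_mul, RingHom.id_apply, mul_add, mul_sum, mul_assoc]
        split_ifs <;> ring }
  have hT : ∀ Γ k, (hk : k ≤ n) → ∑ i ∈ range (n + 1), ext Γ i * x i ^ k +
      (if k = n then ext Γ o * c else 0) = T Γ ⟨k, Nat.lt_succ_iff.mpr hk⟩ := by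
    intro Γ k hk
    simp [T, hext, sum_range, hext Γ ⟨o, ho'⟩]
  have hinj : Function.Injective T := by
    rw [← LinearMap.ker_eq_bot, LinearMap.ker_eq_bot']
    intro Γ hΓ
    have hzero := perturbed_vandermonde_ker (Γ := ext Γ) (card_range _) ho hx hc
      fun k hk => by rw [hT Γ k hk, hΓ, Pi.zero_apply]
    ext i
    rw [← hext Γ i, hzero i (mem_range.mpr i.isLt), Pi.zero_apply]
  obtain ⟨Γ, hΓ⟩ := LinearMap.injective_iff_surjective.mp hinj fun k => b k
  exact ⟨ext Γ, fun k hk => by rw [hT Γ k hk, hΓ]⟩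

/-- The nodes `0, E₀, E₁, …, E_p` of the composed-BDF system. -/
def composedBDFNode (E0 : ℂ) (E : ℕ → ℂ) : ℕ → ℂ
  | 0 => 0
  | 1 => E0
  | i + 2 => E (i + 1)

lemma sum_composedBDFNode (p : ℕ) (E0 : ℂ) (E Γ : ℕ → ℂ) (k : ℕ) :
    ∑ i ∈ range (p + 2), Γ i * composedBDFNode E0 E i ^ k =
      Γ 0 * 0 ^ k + (Γ 1 * E0 ^ k + ∑ i ∈ Icc 1 p, Γ (i + 1) * E i ^ k) := by
  rw [sum_range_succ', sum_range_succ', ← Ico_add_one_right_eq_Icc, sum_Ico_eq_sum_range]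
  simp only [composedBDFNode, Nat.add_sub_cancel, add_comm 1]
  ring

lemma prod_erase_composedBDFNode {M : Type*} [CommMonoid M] (p : ℕ) (E0 : ℂ) (E : ℕ → ℂ)
    (f : ℂ → M) :
    ∏ i ∈ (range (p + 2)).erase 1, f (composedBDFNode E0 E i) =
      f 0 * ∏ i ∈ Icc 1 p, f (E i) := by
  have hset : (range (p + 2)).erase 1 = insert 0 ((Icc 1 p).map (addRightEmbedding 1)) := by
    ext i
    simp only [mem_erase, mem_range, mem_insert, mem_map, mem_Icc, addRightEmbedding_apply]
    refine ⟨fun h => ?_, ?_⟩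
    · rcases Nat.eq_zero_or_pos i with hi | hi
      · exact Or.inl hi
      · exact Or.inr ⟨i - 1, by omega, by omega⟩
    · rintro (rfl | ⟨j, hj, rfl⟩) <;> omega
  rw [hset, prod_insert (by simp), prod_map]
  refine congrArg _ (prod_congr rfl fun i hi => ?_)
  obtain ⟨j, rfl⟩ := Nat.exists_eq_add_of_le' (mem_Icc.mp hi).1
  rfl

/-- The composed-BDF system as a perturbed Vandermonde system. -/
lemma composedBDFSystem_iff {p : ℕ} (hp : 1 ≤ p) {E0 : ℂ} {E ε : ℕ → ℂ} {γ0 a1 : ℂ}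
    {Γ : ℕ → ℂ} :
    ComposedBDFSystem p E0 E ε γ0 a1 Γ ↔
      ∀ k ≤ p + 1, ∑ i ∈ range (p + 2), Γ i * composedBDFNode E0 E i ^ k +
        (if k = p + 1 then Γ 1 * ((-a1) ^ (p + 1) * (∏ i ∈ Icc 1 p, ε i) / γ0) else 0) =
        if k = 1 then -E0 else 0 := by
  constructor
  · rintro ⟨h0, h1, hm, htop⟩ k hk
    rcases Nat.eq_zero_or_pos k with rfl | hk0
    · simpa using h0
    rw [sum_composedBDFNode, zero_pow hk0.ne', mul_zero, zero_add]
    rcases eq_or_ne k 1 with rfl | hk1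
    · rw [if_neg (by omega), if_pos rfl, add_zero]
      simpa using h1
    rw [if_neg hk1]
    rcases eq_or_ne k (p + 1) with rfl | hkp
    · rw [if_pos rfl]
      linear_combination htop
    · rw [if_neg hkp, add_zero]
      exact hm k (by omega) (by omega)
  · intro h
    refine ⟨by simpa using h 0 (Nat.zero_le _), ?_, fun m hm hmp => ?_, ?_⟩
    · have := h 1 (by omega)
      rw [sum_composedBDFNode, if_neg (by omega), if_pos rfl] at this
      simpa using this
    · have := h m (by omega)
      rw [sum_composedBDFNode, if_neg (by omega), if_neg (by omega),
        zero_pow (by omega)] at this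
      simpa using this
    · have := h (p + 1) le_rfl
      rw [sum_composedBDFNode, if_pos rfl, if_neg (by omega), zero_pow (by omega)] at this
      linear_combination this

open Polynomial in
/-- Proposition 1 of the paper, formula for `Γ₁`: in the composed-BDF setup, the
composed-BDF system has a unique solution `(Γ₀, …, Γ_{p+1})`, and
`Γ₁ = -(γ₀ E₀/(E₀ γ₀ - a₁)) ∏_{i=1}^p (1 + ρ_i)/(a₁ + ρ_i)`. -/
theorem composed_bdf_Gamma_one (p : ℕ) (hp : 1 ≤ p) (ρ : ℕ → ℝ)
    (hρ1 : ρ 1 = 0) (hρmono : ∀ j : ℕ, 1 ≤ j → j < p → ρ j < ρ (j + 1))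
    (a1 : ℂ) (ha0 : a1 ≠ 0) (ha1 : a1 ≠ 1)
    (hden : ∀ j ∈ Icc 1 p, a1 + (ρ j : ℂ) ≠ 0)
    (ε E : ℕ → ℂ) (E0 γ0 : ℂ)
    (hε : ∀ j ∈ Icc 1 p, ε j = 1 + (ρ j : ℂ) / a1)
    (hE : ∀ j ∈ Icc 1 p, E j = 1 + (ρ j : ℂ))
    (hE0 : E0 = 1 - a1)
    (hγ0 : γ0 = ∑ j ∈ Icc 1 p, (ε j)⁻¹)
    (hγ0ne : γ0 ≠ 0) (hcrit : E0 * γ0 - a1 ≠ 0) :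
    (∃ Γ : ℕ → ℂ, ComposedBDFSystem p E0 E ε γ0 a1 Γ) ∧
    (∀ Γ Γ' : ℕ → ℂ, ComposedBDFSystem p E0 E ε γ0 a1 Γ →
      ComposedBDFSystem p E0 E ε γ0 a1 Γ' → ∀ i ≤ p + 1, Γ i = Γ' i) ∧
    (∀ Γ : ℕ → ℂ, ComposedBDFSystem p E0 E ε γ0 a1 Γ →
      Γ 1 = -(γ0 * E0 / (E0 * γ0 - a1)) *
        ∏ i ∈ Icc 1 p, (1 + (ρ i : ℂ)) / (a1 + (ρ i : ℂ))) := by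
  set c : ℂ := (-a1) ^ (p + 1) * (∏ i ∈ Icc 1 p, ε i) / γ0 with hc
  set x := composedBDFNode E0 E with hxdef
  set P : ℂ := ∏ i ∈ Icc 1 p, (a1 + (ρ i : ℂ)) with hP
  have hP0 : P ≠ 0 := prod_ne_zero_iff.mpr hden
  have hcard : #(Icc 1 p) = p := by simp
  have hε' : ∏ i ∈ Icc 1 p, ε i = P / a1 ^ p := by
    have : ∏ i ∈ Icc 1 p, ε i = ∏ i ∈ Icc 1 p, (a1 + (ρ i : ℂ)) / a1 :=
      prod_congr rfl fun i hi => by rw [hε i hi]; field_simp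
    rw [this, prod_div_distrib, prod_const, hcard]
  have hprod : ∏ j ∈ (range (p + 2)).erase 1, (x 1 - x j) = E0 * ((-1) ^ p * P) := by
    rw [prod_erase_composedBDFNode p E0 E (fun z => x 1 - z)]
    have hx1 : x 1 = E0 := rfl
    have : ∏ i ∈ Icc 1 p, (x 1 - E i) = ∏ i ∈ Icc 1 p, -(a1 + (ρ i : ℂ)) :=
      prod_congr rfl fun i hi => by rw [hx1, hE i hi, hE0]; ring
    rw [this, prod_neg, hcard, hx1, sub_zero]
  have hpivot : ∏ j ∈ (range (p + 2)).erase 1, (x 1 - x j) + c =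
      (-1) ^ p * P * (E0 * γ0 - a1) / γ0 := by
    rw [hprod, hc, hε', neg_pow]
    field_simp
    ring
  have hpivot0 : ∏ j ∈ (range (p + 2)).erase 1, (x 1 - x j) + c ≠ 0 := by
    rw [hpivot]
    exact div_ne_zero (mul_ne_zero (mul_ne_zero (by simp) hP0) hcrit) hγ0ne
  have hρ : StrictMonoOn ρ (Set.Icc 1 p) :=
    strictMonoOn_of_lt_add_one Set.ordConnected_Icc fun j _ hj hj' => hρmono j hj.1 hj'.2
  have hρ0 : ∀ j ∈ Icc 1 p, 0 ≤ ρ j := fun j hj => by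
    have hj' := mem_Icc.mp hj
    exact hρ1 ▸ hρ.monotoneOn ⟨le_rfl, hp⟩ hj' hj'.1
  have hE_ne : ∀ j ∈ Icc 1 p, E j ≠ 0 := fun j hj => by
    rw [hE j hj]
    exact_mod_cast (by linarith [hρ0 j hj] : (0 : ℝ) < 1 + ρ j).ne'
  have hinj : Set.InjOn x ((range (p + 2)).erase 1) := by
    intro i hi j hj hij
    simp only [coe_erase, Set.mem_sdiff, mem_coe, mem_range, Set.mem_singleton_iff] at hi hj
    match i, j, hi, hj, hij with
    | 0, 0, _, _, _ => rfl
    | 1, _, hi, _, _ => exact absurd rfl hi.2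
    | _, 1, _, hj, _ => exact absurd rfl hj.2
    | 0, j + 2, _, hj, hij => exact absurd hij.symm (hE_ne (j + 1) (mem_Icc.mpr (by omega)))
    | i + 2, 0, hi, _, hij => exact absurd hij (hE_ne (i + 1) (mem_Icc.mpr (by omega)))
    | i + 2, j + 2, hi, hj, hij =>
      have hi' : i + 1 ∈ Icc 1 p := mem_Icc.mpr (by omega)
      have hj' : j + 1 ∈ Icc 1 p := mem_Icc.mpr (by omega)
      have hij' : E (i + 1) = E (j + 1) := hij
      rw [hE _ hi', hE _ hj', add_right_inj, Complex.ofReal_inj] at hij'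
      have := hρ.injOn (mem_Icc.mp hi') (mem_Icc.mp hj') hij'
      omega
  have h1 : 1 ∈ range (p + 2) := mem_range.mpr (by omega)
  simp only [composedBDFSystem_iff hp, ← hc, ← hxdef]
  refine ⟨?_, fun Γ Γ' h h' i hi => ?_, fun Γ h => ?_⟩
  · exact exists_perturbed_vandermonde h1 hinj hpivot0 fun k => if k = 1 then -E0 else 0
  · refine sub_eq_zero.mp (perturbed_vandermonde_ker (Γ := fun i => Γ i - Γ' i) (card_range _) h1
      hinj hpivot0 (fun k hk => ?_) i (mem_range.mpr (by omega)))
    simp only [sub_mul, sum_sub_distrib]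
    have hk1 := h k hk
    have hk2 := h' k hk
    split_ifs at hk1 hk2 ⊢ <;> linear_combination hk1 - hk2
  · have hcoord := perturbed_vandermonde_coord (card_range _) h1 h
    have hcoeff : (∏ j ∈ (range (p + 2)).erase 1, (X - C (x j))).coeff 1 =
        (-1) ^ p * ∏ i ∈ Icc 1 p, (1 + (ρ i : ℂ)) := by
      rw [prod_erase_composedBDFNode p E0 E (fun z => X - C z), C_0, sub_zero, coeff_X_mul,
        coeff_zero_eq_eval_zero, eval_prod]
      simp only [eval_sub, eval_X, eval_C, zero_sub]
      rw [prod_neg, hcard, prod_congr rfl hE]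
    simp only [mul_ite, mul_zero, sum_ite_eq', h1, if_true] at hcoord
    rw [hcoeff, hpivot] at hcoord
    rw [prod_div_distrib, ← hP]
    have hsign : ((-1 : ℂ) ^ p) ≠ 0 := by simp
    field_simp at hcoord ⊢
    linear_combination hcoord
end

section
/- Assume the composed-BDF setup and let (Γ_0, …, Γ_{p+1}) be a solution of the composed-BDF system. Then for every j with 1 ≤ j ≤ p, Γ_{j+1} = (−1)^p · (∏_{i=1, i≠j}^p E_i) / (∏_{ℓ=1, ℓ≠j}^p (E_j − E_ℓ)) · (a_1 − 1)(E_0² γ_0 + a_1² ε_j) / (E_j (ρ_j + a_1)(E_0 γ_0 − a_1)). (Proposition 1 of the paper, formulas for Γ_{j+1} and Γ_{p+1}, stated here in the corrected unified form: for j = p the denominator product is ∏_{ℓ=1}^{p−1}(E_p − E_ℓ) as in equation (B7) of the paper, and the overall sign corrects the misprints (−1)^{j+1} and (−1)^{p+1} of the paper.) -/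
open Finset

/-- The moment equations of the composed-BDF system, tested against `X * g` for a monic
polynomial `g` of degree `p`. -/
theorem ComposedBDFSystem.monic_moment {p : ℕ} (hp : 1 ≤ p) {E0 γ0 a1 : ℂ} {E ε Γ : ℕ → ℂ}
    (h : ComposedBDFSystem p E0 E ε γ0 a1 Γ) {g : Polynomial ℂ} (hg : g.Monic)
    (hdeg : g.natDegree = p) :
    Γ 1 * (E0 * g.eval E0) + ∑ i ∈ Icc 1 p, Γ (i + 1) * (E i * g.eval (E i)) =
      -E0 * g.eval 0 - Γ 1 * ((-a1) ^ (p + 1) * (∏ i ∈ Icc 1 p, ε i) / γ0) := by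
  obtain ⟨-, h1, hm, hlast⟩ := h
  have expand : ∀ x : ℂ, x * g.eval x = ∑ n ∈ range (p + 1), g.coeff n * x ^ (n + 1) := by
    intro x
    rw [Polynomial.eval_eq_sum_range, hdeg, mul_sum]
    exact sum_congr rfl fun n _ => by ring
  have swap : Γ 1 * (E0 * g.eval E0) + ∑ i ∈ Icc 1 p, Γ (i + 1) * (E i * g.eval (E i)) =
      ∑ n ∈ range (p + 1), g.coeff n *
        (Γ 1 * E0 ^ (n + 1) + ∑ i ∈ Icc 1 p, Γ (i + 1) * E i ^ (n + 1)) := by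
    simp only [expand, mul_add, sum_add_distrib, mul_sum]
    rw [sum_comm (s := Icc 1 p)]
    congr 1
    · exact sum_congr rfl fun n _ => by ring
    · exact sum_congr rfl fun n _ => sum_congr rfl fun i _ => by ring
  obtain ⟨q, rfl⟩ : ∃ q, p = q + 1 := ⟨p - 1, by omega⟩
  have middle : ∑ n ∈ range q, g.coeff (n + 1) * (Γ 1 * E0 ^ (n + 1 + 1) +
      ∑ i ∈ Icc 1 (q + 1), Γ (i + 1) * E i ^ (n + 1 + 1)) = 0 := by
    refine sum_eq_zero fun n hn => ?_
    rw [hm (n + 1 + 1) (by omega) (by have := mem_range.mp hn; omega), mul_zero]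
  have lead : g.coeff (q + 1) = 1 := by rw [← hdeg]; exact hg
  rw [swap, sum_range_succ, sum_range_succ', middle, lead, Polynomial.coeff_zero_eq_eval_zero]
  simp only [zero_add, pow_one]
  rw [h1]
  linear_combination hlast

/-- Proposition 1 of the paper (corrected unified form): in the composed-BDF setup,
any solution of the composed-BDF system satisfies, for `1 ≤ j ≤ p`,
`Γ_{j+1} = (-1)^p (∏_{i≠j} E_i)/(∏_{ℓ≠j}(E_j - E_ℓ)) ·
  (a₁ - 1)(E₀² γ₀ + a₁² ε_j)/(E_j (ρ_j + a₁)(E₀ γ₀ - a₁))`. -/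
theorem composed_bdf_Gamma_formula (p : ℕ) (hp : 1 ≤ p) (ρ : ℕ → ℝ)
    (hρ1 : ρ 1 = 0) (hρmono : ∀ j : ℕ, 1 ≤ j → j < p → ρ j < ρ (j + 1))
    (a1 : ℂ) (ha0 : a1 ≠ 0) (ha1 : a1 ≠ 1)
    (hden : ∀ j ∈ Icc 1 p, a1 + (ρ j : ℂ) ≠ 0)
    (ε E : ℕ → ℂ) (E0 γ0 : ℂ)
    (hε : ∀ j ∈ Icc 1 p, ε j = 1 + (ρ j : ℂ) / a1)
    (hE : ∀ j ∈ Icc 1 p, E j = 1 + (ρ j : ℂ))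
    (hE0 : E0 = 1 - a1)
    (hγ0 : γ0 = ∑ j ∈ Icc 1 p, (ε j)⁻¹)
    (hγ0ne : γ0 ≠ 0) (hcrit : E0 * γ0 - a1 ≠ 0)
    (Γ : ℕ → ℂ) (hΓ : ComposedBDFSystem p E0 E ε γ0 a1 Γ) :
    ∀ j : ℕ, 1 ≤ j → j ≤ p →
      Γ (j + 1) = (-1) ^ p *
        ((∏ i ∈ (Icc 1 p).erase j, E i) / (∏ l ∈ (Icc 1 p).erase j, (E j - E l))) *
        ((a1 - 1) * (E0 ^ 2 * γ0 + a1 ^ 2 * ε j)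
          / (E j * ((ρ j : ℂ) + a1) * (E0 * γ0 - a1))) := by
  intro j hj1 hjp
  have hj : j ∈ Icc 1 p := mem_Icc.mpr ⟨hj1, hjp⟩
  have hstrict : StrictMonoOn ρ (Set.Icc 1 p) :=
    strictMonoOn_of_lt_add_one Set.ordConnected_Icc fun a _ ha ha' =>
      hρmono a ha.1 (Nat.lt_of_succ_le ha'.2)
  have hEj : E j ≠ 0 := by
    have hρ : 0 ≤ ρ j := hρ1 ▸ hstrict.monotoneOn ⟨le_rfl, hp⟩ ⟨hj1, hjp⟩ hj1
    rw [hE j hj]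
    exact_mod_cast (by positivity : (1 : ℝ) + ρ j ≠ 0)
  have hdiff : ∏ l ∈ (Icc 1 p).erase j, (E j - E l) ≠ 0 := by
    refine prod_ne_zero_iff.mpr fun l hl => ?_
    obtain ⟨hne, hl⟩ := mem_erase.mp hl
    rw [hE j hj, hE l hl, add_sub_add_left_eq_sub, sub_ne_zero]
    intro heq
    exact hne (hstrict.injOn (mem_Icc.mp hl) (mem_Icc.mp hj) (by exact_mod_cast heq.symm))
  have hsub : ∀ i ∈ Icc 1 p, E0 - E i = -a1 * ε i := by
    intro i hi
    rw [hE0, hE i hi, hε i hi]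
    field_simp
    ring
  have hfull := hΓ.monic_moment hp (g := ∏ i ∈ Icc 1 p, (Polynomial.X - Polynomial.C (E i)))
    (Polynomial.monic_prod_X_sub_C _ _) (by simp)
  have hpart := hΓ.monic_moment hp
    (g := (Polynomial.X - Polynomial.C E0) *
      ∏ i ∈ (Icc 1 p).erase j, (Polynomial.X - Polynomial.C (E i)))
    ((Polynomial.monic_X_sub_C _).mul (Polynomial.monic_prod_X_sub_C _ _)) (by
      rw [(Polynomial.monic_X_sub_C _).natDegree_mul (Polynomial.monic_prod_X_sub_C _ _)]
      simp [card_erase_of_mem hj]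
      omega)
  simp only [Polynomial.eval_mul, Polynomial.eval_prod, Polynomial.eval_sub, Polynomial.eval_X,
    Polynomial.eval_C, sub_self, zero_mul, mul_zero, zero_sub, zero_add] at hfull hpart
  rw [sum_eq_zero fun i hi => by rw [prod_eq_zero hi (sub_self _)]; ring,
    prod_congr rfl hsub, prod_mul_distrib, prod_const, Nat.card_Icc, Nat.add_sub_cancel,
    prod_neg, Nat.card_Icc, Nat.add_sub_cancel, ← mul_prod_erase _ E hj] at hfull
  rw [sum_eq_single_of_mem j hj fun i hi hij => by
      rw [prod_eq_zero (mem_erase.mpr ⟨hij, hi⟩) (sub_self _)]; ring,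
    prod_neg, card_erase_of_mem hj, Nat.card_Icc, Nat.add_sub_cancel] at hpart
  have hsign : (-1 : ℂ) ^ p = -(-1) ^ (p - 1) := by
    obtain ⟨q, rfl⟩ : ∃ q, p = q + 1 := ⟨p - 1, by omega⟩
    simp [pow_succ]
  have hjE : a1 * ε j = E j - E0 := by linear_combination hsub j hj
  have hρj : (ρ j : ℂ) + a1 = a1 * ε j := by
    linear_combination -hjE - hE j hj + hE0
  have hεj : ε j ≠ 0 := by
    refine right_ne_zero_of_mul (a := a1) ?_
    rw [← hρj, add_comm]
    exact hden j hj
  rw [hρj]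
  generalize ∏ i ∈ (Icc 1 p).erase j, E i = P at *
  generalize ∏ l ∈ (Icc 1 p).erase j, (E j - E l) = D at *
  generalize ∏ i ∈ Icc 1 p, ε i = Q at *
  rw [pow_succ] at hfull hpart
  generalize (-a1) ^ p = A at *
  have hΓ1 : Γ 1 * (A * -a1 * Q / γ0) * (E0 * γ0 - a1) = E0 * a1 * ((-1) ^ p * (E j * P)) := by
    field_simp at hfull ⊢
    linear_combination -hfull
  rw [hsign] at hΓ1 ⊢
  have key : Γ (j + 1) * (E j * (a1 * ε j) * D) * (E0 * γ0 - a1) =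
      -(-1) ^ (p - 1) * P * ((a1 - 1) * (E0 ^ 2 * γ0 + a1 ^ 2 * ε j)) := by
    rw [show a1 - 1 = -E0 by rw [hE0]; ring, show a1 ^ 2 * ε j = a1 * (E j - E0) by rw [← hjE]; ring,
      hjE]
    linear_combination (E0 * γ0 - a1) * hpart - hΓ1
  field_simp
  linear_combination key
end

section
/- Assume the composed-BDF setup and let (Γ_0, …, Γ_{p+1}) be the unique solution of the composed-BDF system. Then Γ_{p+1} = 0 if and only if E_0² γ_0 + a_1² ε_p = 0; equivalently, setting a_2 := 1 − a_1, the pair (a_1, a_2) satisfies a_1 + a_2 = 1 and ε_p a_1² + γ_0 a_2² = 0. (This is the algebraic condition (14) on the composition coefficients in Theorem 2 of the paper, under which the twice-composed BDF(p) flow gains one order of accuracy.) -/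
open Finset

open Polynomial in
/-- Testing the composed-BDF system against `X * r` for a monic polynomial `r` of degree `p`. -/
theorem ComposedBDFSystem.eval_monic {p : ℕ} (hp : 1 ≤ p) {E0 : ℂ} {E ε : ℕ → ℂ} {γ0 a1 : ℂ}
    {Γ : ℕ → ℂ} (h : ComposedBDFSystem p E0 E ε γ0 a1 Γ) {r : ℂ[X]} (hr : r.Monic)
    (hdeg : r.natDegree = p) :
    Γ 1 * (E0 * r.eval E0 + (-a1) ^ (p + 1) * (∏ i ∈ Icc 1 p, ε i) / γ0)
      + ∑ i ∈ Icc 1 p, Γ (i + 1) * (E i * r.eval (E i)) = -E0 * r.eval 0 := by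
  obtain ⟨-, h1, hm, hlast⟩ := h
  obtain ⟨n, rfl⟩ : ∃ n, p = n + 1 := ⟨p - 1, by omega⟩
  have hlead : r.coeff (n + 1) = 1 := by rw [← hdeg]; exact hr
  have heval (x : ℂ) : r.eval x
      = ∑ k ∈ range n, r.coeff (k + 1) * x ^ (k + 1) + r.coeff 0 + x ^ (n + 1) := by
    rw [eval_eq_sum_range, hdeg, sum_range_succ, sum_range_succ', hlead]
    simp
  set M : ℕ → ℂ := fun m => Γ 1 * E0 ^ m + ∑ i ∈ Icc 1 (n + 1), Γ (i + 1) * E i ^ m with hM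
  have hmid : ∑ k ∈ range n, r.coeff (k + 1) * M (k + 2) = 0 :=
    sum_eq_zero fun k hk => by
      rw [hM]
      have := mem_range.1 hk
      simp only [hm (k + 2) (by omega) (by omega), mul_zero]
  have hexpand : Γ 1 * (E0 * r.eval E0)
      + ∑ i ∈ Icc 1 (n + 1), Γ (i + 1) * (E i * r.eval (E i))
      = ∑ k ∈ range n, r.coeff (k + 1) * M (k + 2) + r.coeff 0 * M 1 + M (n + 2) := by
    have hterm (c x : ℂ) : c * (x * r.eval x)
        = ∑ k ∈ range n, r.coeff (k + 1) * (c * x ^ (k + 2)) + r.coeff 0 * (c * x ^ 1)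
          + c * x ^ (n + 2) := by
      rw [heval, mul_add, mul_add, mul_add, mul_add, mul_sum, mul_sum]
      congr 1
      · congr 1
        · exact sum_congr rfl fun k _ => by ring
        · ring
      · ring
    simp only [hterm, hM, sum_add_distrib, mul_add, mul_sum]
    rw [sum_comm]
    ring
  have hM1 : M 1 = -E0 := by simpa [hM] using h1
  have h0 : r.eval 0 = r.coeff 0 := (coeff_zero_eq_eval_zero r).symm
  rw [hmid, hM1] at hexpand
  simp only [hM] at hexpand
  rw [h0]
  linear_combination hexpand + hlast

/-- The algebraic condition (14) on the composition coefficients in Theorem 2 of the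
paper: in the composed-BDF setup, the unique solution of the composed-BDF system has
`Γ_{p+1} = 0` iff `E₀² γ₀ + a₁² ε_p = 0`, equivalently, with `a₂ := 1 - a₁`,
iff `a₁ + a₂ = 1` and `ε_p a₁² + γ₀ a₂² = 0`. -/
theorem composed_bdf_order_condition (p : ℕ) (hp : 1 ≤ p) (ρ : ℕ → ℝ)
    (hρ1 : ρ 1 = 0) (hρmono : ∀ j : ℕ, 1 ≤ j → j < p → ρ j < ρ (j + 1))
    (a1 : ℂ) (ha0 : a1 ≠ 0) (ha1 : a1 ≠ 1)
    (hden : ∀ j ∈ Icc 1 p, a1 + (ρ j : ℂ) ≠ 0)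
    (ε E : ℕ → ℂ) (E0 γ0 : ℂ)
    (hε : ∀ j ∈ Icc 1 p, ε j = 1 + (ρ j : ℂ) / a1)
    (hE : ∀ j ∈ Icc 1 p, E j = 1 + (ρ j : ℂ))
    (hE0 : E0 = 1 - a1)
    (hγ0 : γ0 = ∑ j ∈ Icc 1 p, (ε j)⁻¹)
    (hγ0ne : γ0 ≠ 0) (hcrit : E0 * γ0 - a1 ≠ 0)
    (Γ : ℕ → ℂ) (hΓ : ComposedBDFSystem p E0 E ε γ0 a1 Γ) :
    (Γ (p + 1) = 0 ↔ E0 ^ 2 * γ0 + a1 ^ 2 * ε p = 0) ∧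
    (Γ (p + 1) = 0 ↔
      (a1 + (1 - a1) = 1 ∧ ε p * a1 ^ 2 + γ0 * (1 - a1) ^ 2 = 0)) := by
  have hmono : StrictMonoOn ρ (Set.Icc 1 p) := strictMonoOn_of_lt_add_one Set.ordConnected_Icc
    fun j _ hj hj' => hρmono j hj.1 hj'.2
  have hEne : ∀ j ∈ Icc 1 p, E j ≠ 0 := fun j hj => by
    rw [hE j hj]
    have hj' := mem_Icc.1 hj
    have : ρ 1 ≤ ρ j := hmono.monotoneOn ⟨le_rfl, hp⟩ hj' hj'.1
    have hpos : 1 + ρ j ≠ 0 := (by linarith : 0 < 1 + ρ j).ne'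
    exact_mod_cast hpos
  have hεE : ∀ j ∈ Icc 1 p, E0 - E j = -a1 * ε j := fun j hj => by
    rw [hE j hj, hε j hj, hE0]
    field_simp
    ring
  have hE0ne : E0 ≠ 0 := by rw [hE0]; exact sub_ne_zero.2 ha1.symm
  obtain ⟨n, rfl⟩ : ∃ n, p = n + 1 := ⟨p - 1, by omega⟩
  have hlast : n + 1 ∈ Icc 1 (n + 1) := mem_Icc.2 ⟨hp, le_rfl⟩
  have hsub : ∀ j ∈ Icc 1 n, j ∈ Icc 1 (n + 1) := fun j hj =>
    Icc_subset_Icc_right n.le_succ hj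
  have hdiff : ∀ j ∈ Icc 1 n, E (n + 1) - E j ≠ 0 := fun j hj => by
    have hj' := mem_Icc.1 hj
    have : ρ j < ρ (n + 1) := hmono ⟨hj'.1, by omega⟩ ⟨hp, le_rfl⟩ (by omega)
    rw [hE j (hsub j hj), hE _ hlast, add_sub_add_left_eq_sub, sub_ne_zero]
    exact_mod_cast this.ne'
  have hEp0 : E (n + 1) - E0 ≠ 0 := by
    rw [hE _ hlast, hE0]
    convert hden _ hlast using 1
    ring
  have hprodne : ∏ j ∈ Icc 1 n, E j ≠ 0 := prod_ne_zero_iff.2 fun j hj => hEne j (hsub j hj)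
  have hfirst := hΓ.eval_monic hp
    (r := ∏ j ∈ Icc 1 (n + 1), (Polynomial.X - Polynomial.C (E j)))
    (Polynomial.monic_prod_X_sub_C _ _) (by simp)
  have hsecond := hΓ.eval_monic hp
    (r := (Polynomial.X - Polynomial.C E0) *
      ∏ j ∈ Icc 1 n, (Polynomial.X - Polynomial.C (E j)))
    ((Polynomial.monic_X_sub_C _).mul (Polynomial.monic_prod_X_sub_C _ _)) (by
      rw [(Polynomial.monic_X_sub_C _).natDegree_mul (Polynomial.monic_prod_X_sub_C _ _)]
      simp [add_comm])
  simp only [Polynomial.eval_mul, Polynomial.eval_prod, Polynomial.eval_sub, Polynomial.eval_X,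
    Polynomial.eval_C, zero_sub, prod_neg, Nat.card_Icc, Nat.add_sub_cancel, sub_self, zero_mul,
    mul_zero, zero_add] at hfirst hsecond
  rw [sum_eq_zero fun i hi => by rw [prod_eq_zero hi (sub_self _)]; ring, prod_congr rfl hεE,
    prod_mul_distrib, prod_const, Nat.card_Icc, Nat.add_sub_cancel,
    prod_Icc_succ_top (f := E) (by omega)] at hfirst
  rw [sum_Icc_succ_top (by omega), sum_eq_zero fun i hi => by
    rw [prod_eq_zero hi (sub_self _)]; ring] at hsecond
  have hEε : E (n + 1) - E0 = a1 * ε (n + 1) := by linear_combination -hεE _ hlast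
  set P := ∏ j ∈ Icc 1 n, E j
  set D := ∏ j ∈ Icc 1 n, (E (n + 1) - E j)
  have hD : D ≠ 0 := prod_ne_zero_iff.2 hdiff
  set Q := ∏ j ∈ Icc 1 (n + 1), ε j
  have hkey : Γ (n + 1 + 1) * (E (n + 1) * (E (n + 1) - E0) * D * (E0 * γ0 - a1))
      = (-1) ^ n * E0 * P * (E0 ^ 2 * γ0 + a1 ^ 2 * ε (n + 1)) := by
    field_simp at hfirst hsecond
    apply mul_left_cancel₀ hγ0ne
    linear_combination a1 * hfirst + (E0 * γ0 - a1) * hsecond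
      + γ0 * (-1) ^ n * E0 * P * a1 * hEε
  have hiff : Γ (n + 1 + 1) = 0 ↔ E0 ^ 2 * γ0 + a1 ^ 2 * ε (n + 1) = 0 := by
    have hleft : E (n + 1) * (E (n + 1) - E0) * D * (E0 * γ0 - a1) ≠ 0 :=
      mul_ne_zero (mul_ne_zero (mul_ne_zero (hEne _ hlast) hEp0) hD) hcrit
    have hright : (-1) ^ n * E0 * P ≠ 0 :=
      mul_ne_zero (mul_ne_zero (pow_ne_zero _ (by norm_num)) hE0ne) hprodne
    rw [← mul_eq_zero_iff_right hleft, hkey, mul_eq_zero_iff_left hright]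
  refine ⟨hiff, hiff.trans ?_⟩
  rw [← hE0, hE0, add_sub_cancel, add_comm, mul_comm γ0, mul_comm (ε _)]
  simp
end

section
/- Assume the composed-BDF setup. Let A' be the (p+2) × (p+2) coefficient matrix of the composed-BDF system: its first row is (1, 1, …, 1); for m = 1, …, p its (m+1)-st row is (0, E_0^m, E_1^m, …, E_p^m); and its last row is (0, E_0^{p+1} + (−a_1)^{p+1}(∏_{i=1}^p ε_i)/γ_0, E_1^{p+1}, …, E_p^{p+1}). Then det A' = (a_1^p/γ_0) · (∏_{i=1}^p ε_i E_i) · (∏_{1 ≤ i < ℓ ≤ p}(E_ℓ − E_i)) · (γ_0 E_0 − a_1); in particular det A' ≠ 0, so the composed-BDF system has a unique solution. (Equation (B6) of the paper.) -/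
open Finset

theorem prod_Icc_one_eq_prod_fin {M : Type*} [CommMonoid M] (n : ℕ) (f : ℕ → M) :
    ∏ i ∈ Icc 1 n, f i = ∏ i : Fin n, f ((i : ℕ) + 1) := by
  rw [Fin.prod_univ_eq_prod_range (fun i => f (i + 1)) n]
  induction n with
  | zero => simp
  | succ n ih => rw [Finset.prod_Icc_succ_top (by omega), ih, Finset.prod_range_succ]

theorem prod_prod_Ioi_eq_prod_Icc {R : Type*} [CommRing R] (n : ℕ) (F : ℕ → R) :
    ∏ i : Fin n, ∏ j ∈ Ioi i, (F ((j : ℕ) + 1) - F ((i : ℕ) + 1)) =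
      ∏ i ∈ Icc 1 n, ∏ l ∈ Icc 1 n, (if i < l then F l - F i else 1) := by
  simp only [prod_Icc_one_eq_prod_fin]
  refine Finset.prod_congr rfl fun i _ => ?_
  have h : Ioi i = univ.filter fun j : Fin n => i < j := by ext; simp
  rw [h, Finset.prod_filter]
  simp

theorem det_of_pow_succ {R : Type*} [CommRing R] {n : ℕ} (v : Fin n → R) :
    (Matrix.of fun r c : Fin n => v c ^ ((r : ℕ) + 1)).det =
      (∏ i, v i) * ∏ i : Fin n, ∏ j ∈ Ioi i, (v j - v i) := by
  rw [← Matrix.det_vandermonde, ← Matrix.det_transpose (Matrix.vandermonde v),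
    ← Matrix.det_mul_row]
  congr 1
  ext r c
  simp [Matrix.vandermonde_apply, pow_succ']

/-- Determinant of a power matrix whose bottom-left entry is perturbed by `δ`. -/
theorem det_of_pow_succ_add_corner {R : Type*} [CommRing R] {n : ℕ} (v : Fin (n + 1) → R) (δ : R) :
    (Matrix.of fun r c : Fin (n + 1) =>
        v c ^ ((r : ℕ) + 1) + if c = 0 then (if r = Fin.last n then δ else 0) else 0).det =
      (∏ i : Fin n, v i.succ) * (∏ i : Fin n, ∏ j ∈ Ioi i, (v j.succ - v i.succ)) *
        (v 0 * (∏ i : Fin n, (v i.succ - v 0)) + (-1) ^ n * δ) := by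
  have hB := det_of_pow_succ v
  have hC := det_of_pow_succ fun i : Fin n => v i.succ
  rw [Fin.prod_univ_succ, Fin.prod_univ_succ, Fin.prod_Ioi_zero] at hB
  simp only [Fin.prod_Ioi_succ] at hB
  rw [Matrix.det_succ_column_zero] at hB ⊢
  have hsub : ∀ i : Fin (n + 1), (Matrix.of fun r c : Fin (n + 1) =>
      v c ^ ((r : ℕ) + 1) + if c = 0 then (if r = Fin.last n then δ else 0) else 0).submatrix
        i.succAbove Fin.succ =
      (Matrix.of fun r c : Fin (n + 1) => v c ^ ((r : ℕ) + 1)).submatrix i.succAbove Fin.succ := by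
    intro i
    ext r c
    simp [Fin.succ_ne_zero]
  have hlast : (Matrix.of fun r c : Fin (n + 1) => v c ^ ((r : ℕ) + 1)).submatrix
      (Fin.last n).succAbove Fin.succ =
      Matrix.of fun r c : Fin n => v c.succ ^ ((r : ℕ) + 1) := by
    ext r c
    simp
  simp only [hsub, Matrix.of_apply, if_true, mul_add, add_mul, Finset.sum_add_distrib] at hB ⊢
  rw [hB]
  simp only [mul_ite, ite_mul, mul_zero, zero_mul, Finset.sum_ite_eq', Finset.mem_univ, if_true,
    hlast, hC, Fin.val_last]
  ring

/-- Equation (B6) of the paper: determinant of the coefficient matrix `A'` of the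
composed-BDF system (34); in particular `det A' ≠ 0`, so the system has a unique
solution. Here `F 0 = E₀ = 1 - a₁` and `F j = E_j = 1 + ρ_j` for `1 ≤ j ≤ p`. -/
theorem composed_bdf_coefficient_det (p : ℕ) (hp : 1 ≤ p) (ρ : ℕ → ℝ)
    (hρ1 : ρ 1 = 0) (hρmono : ∀ j : ℕ, 1 ≤ j → j < p → ρ j < ρ (j + 1))
    (a1 : ℂ) (ha0 : a1 ≠ 0) (ha1 : a1 ≠ 1)
    (hden : ∀ j ∈ Icc 1 p, a1 + (ρ j : ℂ) ≠ 0)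
    (ε F : ℕ → ℂ) (γ0 : ℂ)
    (hε : ∀ j ∈ Icc 1 p, ε j = 1 + (ρ j : ℂ) / a1)
    (hF0 : F 0 = 1 - a1)
    (hF : ∀ j ∈ Icc 1 p, F j = 1 + (ρ j : ℂ))
    (hγ0 : γ0 = ∑ j ∈ Icc 1 p, (ε j)⁻¹)
    (hγ0ne : γ0 ≠ 0) (hcrit : F 0 * γ0 - a1 ≠ 0)
    (A' : Matrix (Fin (p + 2)) (Fin (p + 2)) ℂ)
    (hA' : ∀ r c : Fin (p + 2),
      A' r c =
        if (r : ℕ) = 0 then 1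
        else if (c : ℕ) = 0 then 0
        else if (r : ℕ) ≤ p then F ((c : ℕ) - 1) ^ (r : ℕ)
        else if (c : ℕ) = 1 then
          F 0 ^ (p + 1) + (-a1) ^ (p + 1) * (∏ i ∈ Icc 1 p, ε i) / γ0
        else F ((c : ℕ) - 1) ^ (p + 1)) :
    A'.det = a1 ^ p / γ0 * (∏ i ∈ Icc 1 p, ε i * F i) *
        (∏ i ∈ Icc 1 p, ∏ l ∈ Icc 1 p, (if i < l then F l - F i else 1)) *
        (γ0 * F 0 - a1) ∧
    A'.det ≠ 0 ∧
    (∃! Γ : Fin (p + 2) → ℂ,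
      A'.mulVec Γ = fun r : Fin (p + 2) => if (r : ℕ) = 1 then -(F 0) else 0) := by
  have hmono : ∀ i l : ℕ, 1 ≤ i → i < l → l ≤ p → ρ i < ρ l := by
    intro i l hi hil
    induction l, hil using Nat.le_induction with
    | base => exact fun h => hρmono i hi h
    | succ l hl ih => exact fun h => (ih (by omega)).trans (hρmono l (by omega) (by omega))
  have hnonneg : ∀ i ∈ Icc 1 p, 0 ≤ ρ i := by
    intro i hi
    rw [mem_Icc] at hi
    rcases hi.1.eq_or_lt with h | h
    · rw [← h, hρ1]
    · exact hρ1 ▸ (hmono 1 i le_rfl h hi.2).le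
  have hεa : ∀ i ∈ Icc 1 p, F i - F 0 = a1 * ε i := by
    intro i hi
    rw [hF i hi, hF0, hε i hi]
    field_simp
    ring
  have hε0 : ∀ i ∈ Icc 1 p, ε i ≠ 0 := by
    intro i hi h
    apply hden i hi
    have := hεa i hi
    rw [h, hF i hi, hF0] at this
    linear_combination this
  have hFne : ∀ i ∈ Icc 1 p, F i ≠ 0 := by
    intro i hi
    rw [hF i hi]
    have := hnonneg i hi
    exact_mod_cast (by positivity : (1 + ρ i : ℝ) ≠ 0)
  have hprod : ∏ i : Fin p, (F ((i : ℕ) + 1) - F 0) = a1 ^ p * ∏ i ∈ Icc 1 p, ε i := by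
    rw [← prod_Icc_one_eq_prod_fin p fun i => F i - F 0, Finset.prod_congr rfl hεa,
      Finset.prod_mul_distrib]
    simp
  have hdet : A'.det = a1 ^ p / γ0 * (∏ i ∈ Icc 1 p, ε i * F i) *
        (∏ i ∈ Icc 1 p, ∏ l ∈ Icc 1 p, (if i < l then F l - F i else 1)) *
        (γ0 * F 0 - a1) := by
    have hminor : A'.submatrix Fin.succ Fin.succ = Matrix.of fun r c : Fin (p + 1) =>
        F (c : ℕ) ^ ((r : ℕ) + 1) + if c = 0 then (if r = Fin.last p then
          (-a1) ^ (p + 1) * (∏ i ∈ Icc 1 p, ε i) / γ0 else 0) else 0 := by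
      ext r c
      rw [Matrix.submatrix_apply, hA', Matrix.of_apply]
      have hr := r.is_lt
      simp only [Fin.val_succ, Nat.add_eq_zero_iff, one_ne_zero, and_false, if_false,
        Nat.add_sub_cancel, Fin.ext_iff, Fin.val_zero, Fin.val_last, Nat.add_eq_right]
      by_cases h1 : (r : ℕ) + 1 ≤ p
      · have h2 : (r : ℕ) ≠ p := by omega
        simp [h1, h2]
      · have h2 : (r : ℕ) = p := by omega
        by_cases h3 : (c : ℕ) = 0 <;> simp [h2, h3]
    have hcol : A'.det = (A'.submatrix Fin.succ Fin.succ).det := by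
      rw [Matrix.det_succ_column_zero, Fin.sum_univ_succ]
      simp [hA']
    rw [hcol, hminor, det_of_pow_succ_add_corner (fun c : Fin (p + 1) => F c)]
    simp only [Fin.val_succ, Fin.val_zero]
    rw [prod_prod_Ioi_eq_prod_Icc, hprod, ← prod_Icc_one_eq_prod_fin p F,
      Finset.prod_mul_distrib]
    have hsign : (-1 : ℂ) ^ p * (-a1) ^ (p + 1) = -a1 ^ (p + 1) := by
      rw [pow_succ, ← mul_assoc, ← mul_pow]
      ring
    rw [mul_div_assoc, ← mul_assoc ((-1 : ℂ) ^ p), hsign]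
    field_simp
    ring
  have hne : A'.det ≠ 0 := by
    rw [hdet]
    refine mul_ne_zero (mul_ne_zero (mul_ne_zero (div_ne_zero (pow_ne_zero _ ha0) hγ0ne) ?_) ?_) ?_
    · exact Finset.prod_ne_zero_iff.2 fun i hi => mul_ne_zero (hε0 i hi) (hFne i hi)
    · refine Finset.prod_ne_zero_iff.2 fun i hi => Finset.prod_ne_zero_iff.2 fun l hl => ?_
      split_ifs with hil
      · have h := hmono i l (mem_Icc.1 hi).1 hil (mem_Icc.1 hl).2
        rw [hF i hi, hF l hl, add_sub_add_left_eq_sub, sub_ne_zero]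
        exact_mod_cast h.ne'
      · exact one_ne_zero
    · rwa [mul_comm]
  refine ⟨hdet, hne, ?_⟩
  have hunit : IsUnit A' := (Matrix.isUnit_iff_isUnit_det A').2 (isUnit_iff_ne_zero.2 hne)
  have hbij : Function.Bijective A'.mulVec :=
    ⟨Matrix.mulVec_injective_iff_isUnit.2 hunit, Matrix.mulVec_surjective_iff_isUnit.2 hunit⟩
  exact hbij.existsUnique _
end
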